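/- Let Ω be a simply connected domain in ℂ containing 0, and let (m_k,n_k)_{k≥0} be a sequence of pairs of positive integers such that (m_k)_{k≥0} is unbounded. Then the set of functions f ∈ H(Ω) such that there exists an infinite set I ⊂ ℕ with f ∈ 𝒩_{m_k,n_k} for all k ∈ I and such that the poles of the Padé approximants [f; m_k/n_k] tend to infinity as k → ∞ along I (i.e., for every R > 0 all poles of [f;m_k/n_k] have modulus > R for all sufficiently large k ∈ I), is a dense G_δ subset of H(Ω). The same assertion holds in the space 𝔽 of formal power series over ℂ endowed with the product topology. -/

import Mathlib

open Polynomial Filter Finset Metric Topology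

noncomputable section

/-- Coefficient sequence extended to integer indices, with `a k = 0` for `k < 0`. -/
def acoefZ (a : ℕ → ℂ) (k : ℤ) : ℂ := if 0 ≤ k then a k.toNat else 0

/-- The Hankel determinant `C_{m,n} = det (a_{m-n+1+i+j})_{0 ≤ i,j ≤ n-1}`. -/
def hankelDet (a : ℕ → ℂ) (m n : ℕ) : ℂ :=
  Matrix.det (Matrix.of fun i j : Fin n => acoefZ a ((m : ℤ) - n + 1 + i + j))

/-- `IsPade a m n P Q` : the rational function `P/Q` is the Padé approximant of type
`(m,n)` of the formal power series `∑ a_k z^k`. -/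
def IsPade (a : ℕ → ℂ) (m n : ℕ) (P Q : Polynomial ℂ) : Prop :=
  P.natDegree ≤ m ∧ Q.natDegree ≤ n ∧ IsCoprime P Q ∧ Q.coeff 0 = 1 ∧
    ∀ j ≤ m + n, (∑ i ∈ Finset.range (j + 1), Q.coeff i * a (j - i)) = P.coeff j

/-- `𝒟_{m,n}` : the set of coefficient sequences whose Hankel determinant `C_{m,n}`
does not vanish. -/
def Dset (m n : ℕ) : Set (ℕ → ℂ) := {a | hankelDet a m n ≠ 0}

/-- `𝒩_{m,n}` : the subset of `𝒟_{m,n}` of series whose Padé denominator has exact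
degree `n`. -/
def Nset (m n : ℕ) : Set (ℕ → ℂ) :=
  {a | hankelDet a m n ≠ 0 ∧
    ∃ P Q : Polynomial ℂ, IsPade a m n P Q ∧ Q.degree = (n : WithBot ℕ)}

/-- The open unit disc in `ℂ`. -/
def unitD : Set ℂ := Metric.ball (0 : ℂ) 1

/-- The submodule of `ℂ → ℂ` of functions holomorphic on `Ω` (normalized to vanish
outside `Ω`, so that a function is determined by its restriction to `Ω`). -/
def holSubmodule (Ω : Set ℂ) : Submodule ℂ (ℂ → ℂ) where
  carrier := {f | DifferentiableOn ℂ f Ω ∧ ∀ z ∉ Ω, f z = 0}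
  add_mem' := fun hf hg => ⟨hf.1.add hg.1, fun z hz => by simp [hf.2 z hz, hg.2 z hz]⟩
  zero_mem' := ⟨differentiableOn_const 0, fun _ _ => rfl⟩
  smul_mem' := fun c f hf => ⟨hf.1.const_smul c, fun z hz => by simp [hf.2 z hz]⟩

/-- `H(Ω)`, the space of holomorphic functions on `Ω`. -/
abbrev Hol (Ω : Set ℂ) := ↥(holSubmodule Ω)

/-- The topology of uniform convergence on compact subsets of `Ω` on `H(Ω)`. -/
instance holTop (Ω : Set ℂ) : TopologicalSpace (Hol Ω) :=
  TopologicalSpace.induced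
    (fun f : Hol Ω => UniformOnFun.ofFun {K : Set Ω | IsCompact K} fun z : Ω => f.1 z)
    inferInstance

/-- The `k`-th Taylor coefficient at `0` of a function `f`. -/
def tc (f : ℂ → ℂ) (k : ℕ) : ℂ := iteratedDeriv k f 0 / k.factorial

/-! ### Linear algebra of Padé denominators -/

/-- The Hankel matrix whose determinant is `hankelDet`. -/
def hankelMatrix (a : ℕ → ℂ) (m n : ℕ) : Matrix (Fin n) (Fin n) ℂ :=
  Matrix.of fun i j : Fin n => acoefZ a ((m : ℤ) - n + 1 + i + j)

/-- Right-hand side of the linear system for the Padé denominator. -/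
def hankelRhs (a : ℕ → ℂ) (m n : ℕ) (i : Fin n) : ℂ := a (m + 1 + i)

/-- The coefficients of the unnormalized Padé denominator, given by Cramer's rule:
entry `j` is the coefficient of degree `n - j`. -/
def cramerVec (a : ℕ → ℂ) (m n : ℕ) : Fin n → ℂ :=
  -((hankelMatrix a m n).adjugate.mulVec (hankelRhs a m n))

/-- The polynomial with constant coefficient `c` and coefficient `v j` in degree `n - j`. -/
def polyOfVec {n : ℕ} (c : ℂ) (v : Fin n → ℂ) : ℂ[X] :=
  C c + ∑ j : Fin n, C (v j) * X ^ (n - (j : ℕ))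

lemma natDegree_polyOfVec_le {n : ℕ} (c : ℂ) (v : Fin n → ℂ) :
    (polyOfVec c v).natDegree ≤ n := by
  refine natDegree_add_le_of_degree_le (by simp) (natDegree_sum_le_of_forall_le _ _ fun j _ => ?_)
  exact (natDegree_C_mul_X_pow_le _ _).trans (Nat.sub_le _ _)

lemma coeff_polyOfVec {n : ℕ} (c : ℂ) (v : Fin n → ℂ) (j : Fin n) :
    (polyOfVec c v).coeff (n - (j : ℕ)) = v j := by
  have hj := j.2
  rw [polyOfVec, coeff_add, coeff_C, if_neg (by omega), finsetSum_coeff,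
    Finset.sum_eq_single j]
  · simp
  · intro b _ hb
    rw [coeff_C_mul_X_pow, if_neg]
    have := b.2
    exact fun h => hb (Fin.ext (by omega))
  · simp

lemma coeff_zero_polyOfVec {n : ℕ} (c : ℂ) (v : Fin n → ℂ) : (polyOfVec c v).coeff 0 = c := by
  rw [polyOfVec, coeff_add, coeff_C_zero, finsetSum_coeff, Finset.sum_eq_zero, add_zero]
  intro j _
  have := j.2
  rw [coeff_C_mul_X_pow, if_neg (by omega)]

lemma eq_polyOfVec {n : ℕ} {Q : ℂ[X]} (hQ : Q.natDegree ≤ n) :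
    Q = polyOfVec (Q.coeff 0) fun j : Fin n => Q.coeff (n - (j : ℕ)) := by
  ext l
  rcases Nat.eq_zero_or_pos l with rfl | hl
  · rw [coeff_zero_polyOfVec]
  · by_cases hln : l ≤ n
    · have := coeff_polyOfVec (Q.coeff 0) (fun j : Fin n => Q.coeff (n - (j : ℕ)))
        ⟨n - l, by omega⟩
      rwa [Nat.sub_sub_self hln, eq_comm] at this
    · rw [coeff_eq_zero_of_natDegree_lt (by omega),
        coeff_eq_zero_of_natDegree_lt ((natDegree_polyOfVec_le _ _).trans_lt (by omega))]

lemma coeff_mul_mk (a : ℕ → ℂ) (Q : ℂ[X]) (j : ℕ) :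
    PowerSeries.coeff j ((Q : PowerSeries ℂ) * PowerSeries.mk a) =
      ∑ i ∈ Finset.range (j + 1), Q.coeff i * a (j - i) := by
  rw [PowerSeries.coeff_mul, Finset.Nat.sum_antidiagonal_eq_sum_range_succ_mk]
  simp

lemma coeff_mul_mk_eq_mulVec (a : ℕ → ℂ) (m n : ℕ) {Q : ℂ[X]} (hQ : Q.natDegree ≤ n)
    (i : Fin n) :
    PowerSeries.coeff (m + 1 + i) ((Q : PowerSeries ℂ) * PowerSeries.mk a) =
      Q.coeff 0 * hankelRhs a m n i +
        ((hankelMatrix a m n).mulVec fun j : Fin n => Q.coeff (n - (j : ℕ))) i := by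
  have key : ∀ N, ∑ l ∈ Finset.range (m + 1 + i + 1), Q.coeff l * a (m + 1 + i - l) =
      ∑ l ∈ Finset.range (m + 1 + i + 1 + N),
        Q.coeff l * acoefZ a ((m : ℤ) + 1 + i - l) := by
    intro N
    rw [Finset.sum_range_add _ (m + 1 + i + 1) N,
      ← add_zero (∑ l ∈ Finset.range (m + 1 + i + 1), _)]
    congr 1
    · refine Finset.sum_congr rfl fun l hl => ?_
      rw [Finset.mem_range] at hl
      rw [acoefZ, if_pos (by omega)]
      congr 2
      omega
    · refine (Finset.sum_eq_zero fun l _ => ?_).symm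
      rw [acoefZ, if_neg (by omega), mul_zero]
  have key2 : ∀ N, ∑ l ∈ Finset.range (n + 1), Q.coeff l * acoefZ a ((m : ℤ) + 1 + i - l) =
      ∑ l ∈ Finset.range (n + 1 + N), Q.coeff l * acoefZ a ((m : ℤ) + 1 + i - l) := by
    intro N
    rw [Finset.sum_range_add _ (n + 1) N, eq_comm, add_eq_left]
    refine Finset.sum_eq_zero fun l _ => ?_
    rw [coeff_eq_zero_of_natDegree_lt (by omega), zero_mul]
  rw [coeff_mul_mk, key (n + 1), add_comm _ (n + 1), ← key2, Finset.sum_range_succ']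
  refine (add_comm _ _).trans ?_
  congr 1
  rw [← Finset.sum_range_reflect, Matrix.mulVec, dotProduct]
  simp only [hankelMatrix, Matrix.of_apply]
  rw [Fin.sum_univ_eq_sum_range (fun j => acoefZ a ((m : ℤ) - n + 1 + i + j) * Q.coeff (n - j)) n]
  refine Finset.sum_congr rfl fun l hl => ?_
  rw [Finset.mem_range] at hl
  rw [mul_comm]
  congr 2 <;> omega

lemma isPade_iff (a : ℕ → ℂ) (m n : ℕ) (P Q : ℂ[X]) :
    IsPade a m n P Q ↔ P.natDegree ≤ m ∧ Q.natDegree ≤ n ∧ IsCoprime P Q ∧ Q.coeff 0 = 1 ∧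
      PowerSeries.X ^ (m + n + 1) ∣
        (Q : PowerSeries ℂ) * PowerSeries.mk a - (P : PowerSeries ℂ) := by
  rw [IsPade, PowerSeries.X_pow_dvd_iff]
  simp only [map_sub, coeff_mul_mk, Polynomial.coeff_coe, sub_eq_zero, Nat.lt_succ_iff]

/-- Any polynomial `Q` killing the coefficients of degree `m + 1, …, m + n` has a numerator. -/
lemma exists_numerator {a : ℕ → ℂ} {m n : ℕ} {Q : ℂ[X]}
    (h : ∀ i : Fin n, PowerSeries.coeff (m + 1 + i)
      ((Q : PowerSeries ℂ) * PowerSeries.mk a) = 0) :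
    ∃ P : ℂ[X], P.natDegree ≤ m ∧
      PowerSeries.X ^ (m + n + 1) ∣
        (Q : PowerSeries ℂ) * PowerSeries.mk a - (P : PowerSeries ℂ) := by
  refine ⟨PowerSeries.trunc (m + 1) ((Q : PowerSeries ℂ) * PowerSeries.mk a),
    Nat.lt_succ_iff.1 (PowerSeries.natDegree_trunc_lt _ _), ?_⟩
  rw [PowerSeries.X_pow_dvd_iff]
  intro j hj
  rw [map_sub, Polynomial.coeff_coe, PowerSeries.coeff_trunc]
  split_ifs with hjm
  · exact sub_self _
  · rw [sub_zero]
    have := h ⟨j - (m + 1), by omega⟩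
    rwa [show m + 1 + (j - (m + 1)) = j by omega] at this

lemma coeff_eq_zero_of_dvd {a : ℕ → ℂ} {m n : ℕ} {P Q : ℂ[X]} (hP : P.natDegree ≤ m)
    (h : PowerSeries.X ^ (m + n + 1) ∣ (Q : PowerSeries ℂ) * PowerSeries.mk a - (P : PowerSeries ℂ))
    (i : Fin n) :
    PowerSeries.coeff (m + 1 + i) ((Q : PowerSeries ℂ) * PowerSeries.mk a) = 0 := by
  have := PowerSeries.X_pow_dvd_iff.1 h (m + 1 + i) (by omega)
  rwa [map_sub, Polynomial.coeff_coe, coeff_eq_zero_of_natDegree_lt (p := P) (by omega),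
    sub_zero] at this

lemma adjugate_mulVec_mulVec {n : ℕ} (M : Matrix (Fin n) (Fin n) ℂ) (v : Fin n → ℂ) :
    M.adjugate.mulVec (M.mulVec v) = M.det • v := by
  rw [Matrix.mulVec_mulVec, Matrix.adjugate_mul, Matrix.smul_mulVec, Matrix.one_mulVec]

/-- Cramer's rule for the denominators. -/
lemma det_mul_eq_polyOfVec {a : ℕ → ℂ} {m n : ℕ} {Q : ℂ[X]} (hQ : Q.natDegree ≤ n)
    (h : ∀ i : Fin n, PowerSeries.coeff (m + 1 + i)
      ((Q : PowerSeries ℂ) * PowerSeries.mk a) = 0) :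
    C (hankelDet a m n) * Q =
      C (Q.coeff 0) * polyOfVec (hankelDet a m n) (cramerVec a m n) := by
  have h1 : (hankelMatrix a m n).mulVec (fun j : Fin n => Q.coeff (n - (j : ℕ))) =
      -(Q.coeff 0 • hankelRhs a m n) := by
    ext i
    have := h i
    rw [coeff_mul_mk_eq_mulVec a m n hQ] at this
    simp only [Pi.neg_apply, Pi.smul_apply, smul_eq_mul]
    linear_combination this
  have h2 := adjugate_mulVec_mulVec (hankelMatrix a m n)
    (fun j : Fin n => Q.coeff (n - (j : ℕ)))
  rw [h1, Matrix.mulVec_neg, Matrix.mulVec_smul] at h2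
  have h3 : (fun j : Fin n => (C (hankelDet a m n) * Q).coeff (n - (j : ℕ))) =
      Q.coeff 0 • cramerVec a m n := by
    ext j
    have := congrFun h2 j
    simp only [Pi.neg_apply, Pi.smul_apply, smul_eq_mul] at this
    rw [coeff_C_mul, cramerVec, Pi.smul_apply, Pi.neg_apply, smul_eq_mul, mul_neg, this]
    rfl
  rw [eq_polyOfVec (Q := C (hankelDet a m n) * Q) ((natDegree_C_mul_le _ _).trans hQ), h3,
    coeff_C_mul, polyOfVec, polyOfVec, mul_add, Finset.mul_sum]
  simp only [Pi.smul_apply, smul_eq_mul, C_mul, mul_assoc]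
  rw [mul_comm]

lemma coeff_cramer_eq_zero (a : ℕ → ℂ) (m n : ℕ) (i : Fin n) :
    PowerSeries.coeff (m + 1 + i) ((polyOfVec (hankelDet a m n) (cramerVec a m n) :
      PowerSeries ℂ) * PowerSeries.mk a) = 0 := by
  rw [coeff_mul_mk_eq_mulVec a m n (natDegree_polyOfVec_le _ _), coeff_zero_polyOfVec]
  simp only [coeff_polyOfVec]
  rw [cramerVec, Matrix.mulVec_neg, Matrix.mulVec_mulVec, Matrix.mul_adjugate,
    Matrix.smul_mulVec, Matrix.one_mulVec]
  exact add_neg_cancel _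

/-- If the Hankel determinant does not vanish, the Padé approximant exists. -/
lemma exists_isPade {a : ℕ → ℂ} {m n : ℕ} (h : hankelDet a m n ≠ 0) :
    ∃ P Q : ℂ[X], IsPade a m n P Q := by
  set D := polyOfVec (hankelDet a m n) (cramerVec a m n) with hD
  obtain ⟨P, hPm, hP⟩ := exists_numerator (coeff_cramer_eq_zero a m n)
  have hD0 : D.coeff 0 = hankelDet a m n := coeff_zero_polyOfVec _ _
  have hcop : IsCoprime P D := by
    by_contra hnc
    obtain ⟨α, hαP, hαD⟩ : ∃ α, P.eval α = 0 ∧ D.eval α = 0 := by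
      by_contra! hne
      exact hnc (isCoprime_iff_aeval_ne_zero_of_isAlgClosed ℂ ℂ _ _ |>.2 fun α => by
        by_cases hα : P.eval α = 0
        · exact Or.inr (by simpa [coe_aeval_eq_eval] using hne α hα)
        · exact Or.inl (by simpa [coe_aeval_eq_eval] using hα))
    obtain ⟨P', rfl⟩ := dvd_iff_isRoot.2 hαP
    obtain ⟨D', hD'⟩ := dvd_iff_isRoot.2 hαD
    have hα : α ≠ 0 := by
      rintro rfl
      exact h (by rw [← hD0, coeff_zero_eq_eval_zero]; exact hαD)
    have hu : IsUnit (((X - C α : ℂ[X])) : PowerSeries ℂ) := by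
      rw [PowerSeries.isUnit_iff_constantCoeff]
      simpa using hα
    have hdvd : PowerSeries.X ^ (m + n + 1) ∣
        (D' : PowerSeries ℂ) * PowerSeries.mk a - (P' : PowerSeries ℂ) := by
      rw [← hu.dvd_mul_left]
      rw [← hD, hD', Polynomial.coe_mul, Polynomial.coe_mul, mul_assoc, ← mul_sub] at hP
      exact hP
    have hX : (X - C α : ℂ[X]).Monic := monic_X_sub_C α
    have hP'm : P'.natDegree ≤ m := by
      rcases eq_or_ne P' 0 with rfl | hne
      · simp
      · rw [hX.natDegree_mul' hne] at hPm
        omega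
    have hD'0 : D' ≠ 0 := by
      rintro rfl
      rw [hD', mul_zero, coeff_zero] at hD0
      exact h hD0.symm
    have hD'n : D'.natDegree ≤ n := by
      have hDn : D.natDegree ≤ n := natDegree_polyOfVec_le _ _
      rw [hD', hX.natDegree_mul' hD'0] at hDn
      omega
    have hmul := det_mul_eq_polyOfVec hD'n (coeff_eq_zero_of_dvd hP'm hdvd)
    rw [← hD, hD', ← mul_assoc] at hmul
    have heq := mul_right_cancel₀ hD'0 hmul
    have hc1 := congrArg (fun p => p.coeff 1) heq
    have hc0 := congrArg (fun p => p.coeff 0) heq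
    simp [coeff_X, coeff_C] at hc1 hc0
    exact h (by rw [hc0, ← hc1, zero_mul, neg_zero])
  have hc : IsUnit (C (hankelDet a m n)⁻¹) := isUnit_C.2 (inv_ne_zero h).isUnit
  refine ⟨C (hankelDet a m n)⁻¹ * P, C (hankelDet a m n)⁻¹ * D, (isPade_iff _ _ _ _ _).2
    ⟨(natDegree_C_mul_le _ _).trans hPm,
    (natDegree_C_mul_le _ _).trans (natDegree_polyOfVec_le _ _), ?_, ?_, ?_⟩⟩
  · exact (isCoprime_mul_unit_left hc _ _).2 hcop
  · rw [coeff_C_mul, hD0, inv_mul_cancel₀ h]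
  · rw [Polynomial.coe_mul, Polynomial.coe_mul, mul_assoc, ← mul_sub]
    exact hP.mul_left _

/-- A Padé approximant whose denominator has exact degree `n` forces the Hankel determinant
not to vanish. -/
lemma hankelDet_ne_zero_of_isPade {a : ℕ → ℂ} {m n : ℕ} {P Q : ℂ[X]} (h : IsPade a m n P Q)
    (hQn : Q.natDegree = n) : hankelDet a m n ≠ 0 := by
  intro hdet
  obtain ⟨hPm, -, hcop, hQ0, hdvd⟩ := (isPade_iff _ _ _ _ _).1 h
  obtain ⟨v, hv, hMv⟩ := Matrix.exists_mulVec_eq_zero_iff.2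
    (show (hankelMatrix a m n).det = 0 from hdet)
  set W := polyOfVec 0 v with hW
  have hWn : W.natDegree ≤ n := natDegree_polyOfVec_le _ _
  obtain ⟨U, hUm, hU⟩ := exists_numerator (a := a) (m := m) (n := n) (Q := W) fun i => by
    rw [coeff_mul_mk_eq_mulVec a m n hWn, hW, coeff_zero_polyOfVec]
    simp only [coeff_polyOfVec, hMv]
    simp
  have hWP : W * P = U * Q := by
    have h1 : (PowerSeries.X : PowerSeries ℂ) ^ (m + n + 1) ∣ ((W * P - U * Q : ℂ[X]) :
        PowerSeries ℂ) := by
      have := dvd_sub (hU.mul_left (Q : PowerSeries ℂ)) (hdvd.mul_left (W : PowerSeries ℂ))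
      convert this using 1
      push_cast
      ring
    have h2 : (W * P - U * Q).natDegree ≤ m + n :=
      (natDegree_sub_le _ _).trans (max_le
        (natDegree_mul_le.trans (by omega)) (natDegree_mul_le.trans (by omega)))
    refine sub_eq_zero.1 (Polynomial.ext fun j => ?_)
    by_cases hj : j < m + n + 1
    · rw [← Polynomial.coeff_coe]
      exact PowerSeries.X_pow_dvd_iff.1 h1 j hj
    · rw [coeff_eq_zero_of_natDegree_lt (by omega), coeff_zero]
  have hQW : Q ∣ W := hcop.symm.dvd_of_dvd_mul_right (hWP ▸ dvd_mul_left _ _)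
  have hW0 : W = 0 := by
    obtain ⟨T, hT⟩ := hQW
    by_contra hne
    have hT0 : T ≠ 0 := right_ne_zero_of_mul (hT ▸ hne)
    have hQne : Q ≠ 0 := left_ne_zero_of_mul (hT ▸ hne)
    have hdeg := natDegree_mul hQne hT0
    rw [← hT] at hdeg
    have hTc := eq_C_of_natDegree_eq_zero (p := T) (by omega)
    have hc := congrArg (fun p => p.coeff 0) hT
    simp only [hW, coeff_zero_polyOfVec, mul_coeff_zero, hQ0, one_mul] at hc
    rw [← hc, C_0] at hTc
    exact hT0 hTc
  apply hv
  ext j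
  rw [← coeff_polyOfVec 0 v j, ← hW, hW0]
  simp

/-! ### The sets of series with good Padé approximants -/

/-- Series in `𝒩_{m,n}` all of whose Padé poles have modulus larger than `R`. -/
def poleFreeSet (m n : ℕ) (R : ℝ) : Set (ℕ → ℂ) :=
  {a | ∃ P Q : ℂ[X], (a ∈ Nset m n ∧ IsPade a m n P Q) ∧ ∀ z : ℂ, Q.eval z = 0 → R < ‖z‖}

lemma poleFreeSet_anti (m n : ℕ) {R R' : ℝ} (h : R ≤ R') :
    poleFreeSet m n R' ⊆ poleFreeSet m n R := fun _ ⟨P, Q, hPQ, hz⟩ =>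
  ⟨P, Q, hPQ, fun z hQ => h.trans_lt (hz z hQ)⟩

lemma IsPade.eval_eq {a : ℕ → ℂ} {m n : ℕ} {P Q : ℂ[X]} (h : IsPade a m n P Q) :
    C (hankelDet a m n) * Q = polyOfVec (hankelDet a m n) (cramerVec a m n) := by
  obtain ⟨hPm, hQn, -, hQ0, hdvd⟩ := (isPade_iff _ _ _ _ _).1 h
  rw [det_mul_eq_polyOfVec hQn (coeff_eq_zero_of_dvd hPm hdvd), hQ0, C_1, one_mul]

lemma poleFreeSet_eq (m : ℕ) {n : ℕ} (hn : 0 < n) (R : ℝ) :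
    poleFreeSet m n R = {a | hankelDet a m n ≠ 0 ∧ cramerVec a m n ⟨0, hn⟩ ≠ 0 ∧
      ∀ z ∈ Metric.closedBall (0 : ℂ) R,
        (polyOfVec (hankelDet a m n) (cramerVec a m n)).eval z ≠ 0} := by
  have key : ∀ {a : ℕ → ℂ} {P Q : ℂ[X]}, hankelDet a m n ≠ 0 → IsPade a m n P Q →
      (Q.degree = n ↔ cramerVec a m n ⟨0, hn⟩ ≠ 0) := by
    intro a P Q hdet hPQ
    have h1 := coeff_polyOfVec (hankelDet a m n) (cramerVec a m n) ⟨0, hn⟩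
    rw [← hPQ.eval_eq, coeff_C_mul] at h1
    rw [← h1, degree_eq_iff_natDegree_eq_of_pos hn, mul_ne_zero_iff_left hdet]
    refine ⟨?_, fun h => le_antisymm hPQ.2.1 (le_natDegree_of_ne_zero h)⟩
    rintro rfl h0
    rw [Nat.sub_zero, coeff_natDegree, leadingCoeff_eq_zero] at h0
    simp [h0] at hn
  ext a
  constructor
  · rintro ⟨P, Q, ⟨⟨hdet, P', Q', hPQ', hdeg⟩, hPQ⟩, hz⟩
    refine ⟨hdet, (key hdet hPQ').1 hdeg, fun z hzR h0 => ?_⟩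
    rw [← hPQ.eval_eq, eval_mul, eval_C, mul_eq_zero_iff_left hdet] at h0
    rw [mem_closedBall_zero_iff] at hzR
    exact absurd (hz z h0) hzR.not_gt
  · rintro ⟨hdet, hc, hz⟩
    obtain ⟨P, Q, hPQ⟩ := exists_isPade hdet
    refine ⟨P, Q, ⟨⟨hdet, P, Q, hPQ, (key hdet hPQ).2 hc⟩, hPQ⟩, fun z h0 => ?_⟩
    by_contra hzR
    refine hz z (by simpa using hzR) ?_
    rw [← hPQ.eval_eq, eval_mul, h0, mul_zero]

lemma continuous_acoefZ (k : ℤ) : Continuous fun a : ℕ → ℂ => acoefZ a k := by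
  unfold acoefZ
  split_ifs
  · exact continuous_apply _
  · exact continuous_const

lemma continuous_hankelMatrix (m n : ℕ) : Continuous fun a : ℕ → ℂ => hankelMatrix a m n :=
  continuous_matrix fun _ _ => continuous_acoefZ _

lemma continuous_hankelDet (m n : ℕ) : Continuous fun a : ℕ → ℂ => hankelDet a m n :=
  (continuous_hankelMatrix m n).matrix_det

lemma continuous_cramerVec (m n : ℕ) : Continuous fun a : ℕ → ℂ => cramerVec a m n :=
  ((continuous_hankelMatrix m n).matrix_adjugate.matrix_mulVec
    (continuous_pi fun _ => continuous_apply _)).neg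

lemma isOpen_poleFreeSet (m : ℕ) {n : ℕ} (hn : 0 < n) (R : ℝ) :
    IsOpen (poleFreeSet m n R) := by
  rw [poleFreeSet_eq m hn]
  have hv := continuous_cramerVec m n
  have hd := continuous_hankelDet m n
  have hF : Continuous fun p : (ℕ → ℂ) × ℂ =>
      (polyOfVec (hankelDet p.1 m n) (cramerVec p.1 m n)).eval p.2 := by
    simp only [polyOfVec, eval_add, eval_C, eval_finsetSum, eval_mul, eval_pow, eval_X]
    refine (hd.comp continuous_fst).add (continuous_finsetSum _ fun j _ => ?_)
    exact (((continuous_apply j).comp hv).comp continuous_fst).mul (continuous_snd.pow _)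
  refine (isOpen_ne_fun hd continuous_const).inter
    ((isOpen_ne_fun ((continuous_apply _).comp hv) continuous_const).inter ?_)
  refine isOpen_iff_eventually.2 fun a ha => ?_
  refine (isCompact_closedBall (0 : ℂ) R).eventually_forall_of_forall_eventually fun z hz => ?_
  exact hF.continuousAt.eventually_ne (ha z hz)

lemma setOf_exists_subsequence_eq {X : Type*} (τ : X → ℕ → ℂ) (m n : ℕ → ℕ) :
    {x : X | ∃ σ : ℕ → ℕ, StrictMono σ ∧
        ∃ P Q : ℕ → Polynomial ℂ,
          (∀ k, τ x ∈ Nset (m (σ k)) (n (σ k)) ∧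
            IsPade (τ x) (m (σ k)) (n (σ k)) (P k) (Q k)) ∧
          ∀ R : ℝ, 0 < R → ∃ N : ℕ, ∀ k ≥ N, ∀ z : ℂ, (Q k).eval z = 0 → R < ‖z‖} =
      ⋂ N : ℕ, ⋃ k ≥ N, τ ⁻¹' poleFreeSet (m k) (n k) N := by
  ext x
  simp only [Set.mem_ofPred, Set.mem_iInter, Set.mem_iUnion, Set.mem_preimage]
  constructor
  · rintro ⟨σ, hσ, P, Q, hPQ, hR⟩ N
    obtain ⟨k₀, hk₀⟩ := hR (N + 1) (by positivity)
    refine ⟨σ (max k₀ N), (le_max_right _ _).trans (hσ.id_le _), P (max k₀ N), Q (max k₀ N),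
      hPQ _, fun z hz => ?_⟩
    have := hk₀ _ (le_max_left _ _) z hz
    linarith
  · intro h
    obtain ⟨σ, hσ, hN⟩ := Filter.extraction_forall_of_frequently
      (P := fun N k => τ x ∈ poleFreeSet (m k) (n k) N) fun N => by
        refine Filter.frequently_atTop.2 fun k₀ => ?_
        obtain ⟨k, hk, hx⟩ := h (max N k₀)
        exact ⟨k, (le_max_right _ _).trans hk,
          poleFreeSet_anti _ _ (by exact_mod_cast le_max_left N k₀) hx⟩
    choose P Q hPQ hz using hN
    refine ⟨σ, hσ, P, Q, hPQ, fun R _ => ?_⟩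
    obtain ⟨N, hRN⟩ := exists_nat_ge R
    exact ⟨N, fun k hk z hQ => (hRN.trans (by exact_mod_cast hk)).trans_lt (hz k z hQ)⟩

/-! ### Polynomials close to having far away Padé poles -/

/-- `p * ∑_{i ≤ L} (-c)^i z^{n i}` as a polynomial in `c` with coefficients in `ℂ[X]`: up to
high order terms this is the Taylor expansion of `p / (1 + c z^n)`. -/
def geomPoly (p : ℂ[X]) (n L : ℕ) : ℂ[X][X] :=
  C p * ∑ i ∈ Finset.range L, (C (-X ^ n) * X) ^ i

lemma eval_geomPoly (p : ℂ[X]) (n L : ℕ) (c : ℂ) :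
    (geomPoly p n L).eval (C c) = p * ∑ i ∈ Finset.range L, (-X ^ n * C c) ^ i := by
  simp [geomPoly, eval_finsetSum]

lemma geomPoly_mem_poleFreeSet {p : ℂ[X]} {m n : ℕ} (hn : 0 < n)
    (hpm : p.natDegree ≤ m) {c : ℂ} {R : ℝ} (hc : c ≠ 0)
    (hcR : ‖c‖ * R ^ n < 1) (hcp : ∀ z, p.eval z = 0 → ‖c‖ * ‖z‖ ^ n < 1) :
    ((geomPoly p n (m + n + 1)).eval (C c)).coeff ∈ poleFreeSet m n R := by
  set Q : ℂ[X] := 1 + C c * X ^ n with hQ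
  have hroot : ∀ z, Q.eval z = 0 → ‖c‖ * ‖z‖ ^ n = 1 := by
    intro z hz
    have : c * z ^ n = -1 := by
      simp only [hQ, eval_add, eval_one, eval_mul, eval_C, eval_pow, eval_X] at hz
      linear_combination hz
    rw [← norm_pow, ← norm_mul, this, norm_neg, norm_one]
  have hQdeg : Q.degree = n := by
    rw [hQ, add_comm, ← C_1, degree_add_C]
    · exact degree_C_mul_X_pow n hc
    · rw [degree_C_mul_X_pow n hc]
      exact_mod_cast hn
  have hQn : Q.natDegree = n := natDegree_eq_of_degree_eq_some hQdeg
  have hPQ : IsPade ((geomPoly p n (m + n + 1)).eval (C c)).coeff m n p Q := by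
    refine (isPade_iff _ _ _ _ _).2 ⟨hpm, hQn.le, ?_, ?_, ?_⟩
    · refine isCoprime_iff_aeval_ne_zero_of_isAlgClosed ℂ ℂ _ _ |>.2 fun z => ?_
      simp only [coe_aeval_eq_eval]
      rw [← not_and_or]
      rintro ⟨h1, h2⟩
      exact (hcp z h1).ne (hroot z h2)
    · simp [hQ, hn.ne]
    · rw [show PowerSeries.mk ((geomPoly p n (m + n + 1)).eval (C c)).coeff =
        (((geomPoly p n (m + n + 1)).eval (C c) : ℂ[X]) : PowerSeries ℂ) by ext; simp]
      rw [← Polynomial.coe_mul, ← Polynomial.coe_sub, eval_geomPoly]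
      have hgeom : Q * (p * ∑ i ∈ Finset.range (m + n + 1), (-X ^ n * C c) ^ i) - p =
          X ^ (m + n + 1) * (-p * (-1) ^ (m + n + 1) * C c ^ (m + n + 1) *
            X ^ ((n - 1) * (m + n + 1))) := by
        have h1 := mul_neg_geom_sum (-X ^ n * C c : ℂ[X]) (m + n + 1)
        have h2 : (X : ℂ[X]) ^ n = X * X ^ (n - 1) := by
          rw [← pow_succ', Nat.sub_add_cancel hn]
        have h3 : (-X ^ n * C c : ℂ[X]) ^ (m + n + 1) =
            X ^ (m + n + 1) * ((-1) ^ (m + n + 1) * C c ^ (m + n + 1) *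
            X ^ ((n - 1) * (m + n + 1))) := by
          rw [h2, pow_mul]
          ring
        rw [h3] at h1
        rw [hQ]
        linear_combination p * h1
      rw [hgeom, Polynomial.coe_mul, Polynomial.coe_pow, Polynomial.coe_X]
      exact dvd_mul_right _ _
  refine ⟨p, Q, ⟨⟨hankelDet_ne_zero_of_isPade hPQ hQn, p, Q, hPQ, hQdeg⟩, hPQ⟩, fun z hz => ?_⟩
  by_contra! hzR
  have h1 := hroot z hz
  have h2 : ‖c‖ * ‖z‖ ^ n ≤ ‖c‖ * R ^ n := by gcongr
  linarith

/-- The abstract density and `G_δ` statement: it only uses that polynomials are dense and that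
polynomial families of polynomials are continuous in the parameter. -/
lemma isGδ_and_dense_of_denseRange {X : Type*} [TopologicalSpace X] [BaireSpace X]
    (τ : X → ℕ → ℂ) (hτ : Continuous τ) (T : ℂ[X] → X) (hT : DenseRange T)
    (hτT : ∀ p, τ (T p) = p.coeff)
    (hTc : ∀ B : ℂ[X][X], Continuous fun c : ℂ => T (B.eval (C c)))
    (m n : ℕ → ℕ) (hn : ∀ k, 0 < n k) (hub : ∀ N : ℕ, ∃ k, N < m k) :
    IsGδ {x : X | ∃ σ : ℕ → ℕ, StrictMono σ ∧
        ∃ P Q : ℕ → Polynomial ℂ,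
          (∀ k, τ x ∈ Nset (m (σ k)) (n (σ k)) ∧
            IsPade (τ x) (m (σ k)) (n (σ k)) (P k) (Q k)) ∧
          ∀ R : ℝ, 0 < R → ∃ N : ℕ, ∀ k ≥ N, ∀ z : ℂ, (Q k).eval z = 0 → R < ‖z‖} ∧
      Dense {x : X | ∃ σ : ℕ → ℕ, StrictMono σ ∧
        ∃ P Q : ℕ → Polynomial ℂ,
          (∀ k, τ x ∈ Nset (m (σ k)) (n (σ k)) ∧
            IsPade (τ x) (m (σ k)) (n (σ k)) (P k) (Q k)) ∧
          ∀ R : ℝ, 0 < R → ∃ N : ℕ, ∀ k ≥ N, ∀ z : ℂ, (Q k).eval z = 0 → R < ‖z‖} := by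
  have hopen : ∀ N : ℕ, IsOpen (⋃ k ≥ N, τ ⁻¹' poleFreeSet (m k) (n k) N) := fun N =>
    isOpen_iUnion fun k => isOpen_iUnion fun _ => (isOpen_poleFreeSet _ (hn k) _).preimage hτ
  rw [setOf_exists_subsequence_eq]
  refine ⟨.iInter_of_isOpen hopen, dense_iInter_of_isOpen hopen fun N => ?_⟩
  have hnz : ∀ p : ℂ[X], p ≠ 0 →
      T p ∈ closure (⋃ k ≥ N, τ ⁻¹' poleFreeSet (m k) (n k) N) := by
    intro p hp
    obtain ⟨k, hkN, hkm⟩ : ∃ k ≥ N, p.natDegree ≤ m k := by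
      obtain ⟨k, hk⟩ := hub (p.natDegree + ∑ i ∈ Finset.range N, m i)
      refine ⟨k, ?_, by omega⟩
      by_contra! hkN
      have := Finset.single_le_sum (f := m) (fun _ _ => Nat.zero_le _) (Finset.mem_range.2 hkN)
      omega
    have hlim : ∀ r : ℝ, ∀ᶠ c : ℂ in 𝓝 0, ‖c‖ * r < 1 := fun r =>
      (show ContinuousAt (fun c : ℂ => ‖c‖ * r) 0 by fun_prop).eventually_lt_const (by simp)
    have hroots : ∀ᶠ c : ℂ in 𝓝 0, ∀ z ∈ p.roots.toFinset, ‖c‖ * ‖z‖ ^ n k < 1 :=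
      (Finset.eventually_all _).2 fun z _ => hlim _
    have hten := (hTc (geomPoly p (n k) (m k + n k + 1))).tendsto 0
    have h0 : (geomPoly p (n k) (m k + n k + 1)).eval (C 0) = p := by
      rw [eval_geomPoly]
      simp [Finset.sum_range_succ']
    rw [h0] at hten
    refine mem_closure_of_tendsto (hten.mono_left (nhdsWithin_le_nhds (s := {0}ᶜ))) ?_
    filter_upwards [self_mem_nhdsWithin, nhdsWithin_le_nhds hroots,
      nhdsWithin_le_nhds (hlim ((N : ℝ) ^ n k))] with c hc hcr hcN
    refine Set.mem_iUnion₂.2 ⟨k, hkN, ?_⟩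
    rw [Set.mem_preimage, hτT]
    refine geomPoly_mem_poleFreeSet (hn k) hkm hc hcN fun z hz => hcr z ?_
    simpa [hp] using hz
  refine dense_iff_closure_eq.2 (Set.eq_univ_of_univ_subset ?_)
  rw [← hT.closure_range]
  refine closure_minimal ?_ isClosed_closure
  rintro _ ⟨p, rfl⟩
  by_cases hp : p = 0
  · have hten := (hTc (C p + Polynomial.X)).tendsto 0
    simp only [eval_add, eval_C, eval_X, map_zero, add_zero] at hten
    refine isClosed_closure.mem_of_tendsto
      (hten.mono_left (nhdsWithin_le_nhds (s := {0}ᶜ))) ?_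
    filter_upwards [self_mem_nhdsWithin] with c hc
    exact hnz _ (by simpa [hp] using hc)
  · exact hnz p hp

lemma continuous_coeff_eval_C (B : ℂ[X][X]) (j : ℕ) :
    Continuous fun c : ℂ => (B.eval (C c)).coeff j := by
  simp only [eval_eq_sum_range, finsetSum_coeff, ← C_pow, coeff_mul_C]
  fun_prop

lemma denseRange_coeff : DenseRange fun p : ℂ[X] => p.coeff := by
  intro a
  refine mem_closure_of_tendsto (f := fun N : ℕ => fun j => if j < N then a j else 0)
    (b := atTop) ?_ (Eventually.of_forall fun N => ?_)
  · rw [tendsto_pi_nhds]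
    intro j
    refine tendsto_const_nhds.congr' ?_
    filter_upwards [eventually_gt_atTop j] with N hN
    rw [if_pos hN]
  · refine ⟨PowerSeries.trunc N (PowerSeries.mk a), ?_⟩
    ext j
    simp [PowerSeries.coeff_trunc]

/-! ### The Cauchy–Pompeiu formula for compactly supported functions -/

/-- Twice the `∂̄`-derivative of `φ`. -/
def dbar (φ : ℂ → ℂ) (w : ℂ) : ℂ := fderiv ℝ φ w 1 + Complex.I * fderiv ℝ φ w Complex.I

lemma continuous_dbar {φ : ℂ → ℂ} (hφ : ContDiff ℝ 1 φ) : Continuous (dbar φ) := by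
  have := hφ.continuous_fderiv (by simp)
  unfold dbar
  fun_prop

lemma exp_neg_mul_dbar (φ : ℂ → ℂ) (w : ℂ) (θ : ℝ) :
    Complex.exp (-(θ * Complex.I)) * dbar φ w =
      fderiv ℝ φ w (Complex.exp (θ * Complex.I)) +
        Complex.I * fderiv ℝ φ w (Complex.I * Complex.exp (θ * Complex.I)) := by
  have h1 : Complex.exp (θ * Complex.I) =
      Real.cos θ • (1 : ℂ) + Real.sin θ • Complex.I := by
    rw [Complex.exp_mul_I]; simp
  have h2 : Complex.I * Complex.exp (θ * Complex.I) =
      (-Real.sin θ) • (1 : ℂ) + Real.cos θ • Complex.I := by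
    rw [h1]
    simp only [Complex.real_smul]
    push_cast
    linear_combination Complex.sin θ * Complex.I_mul_I
  rw [h2, h1, map_add, map_add, map_smul, map_smul, map_smul, map_smul, dbar,
    ← neg_mul, Complex.exp_mul_I]
  simp only [Complex.real_smul, Complex.cos_neg, Complex.sin_neg]
  push_cast
  linear_combination (-Complex.sin θ * fderiv ℝ φ w Complex.I) * Complex.I_mul_I

/-- Polar coordinates around `z`. -/
def polarMap (z : ℂ) (p : ℝ × ℝ) : ℂ := z + p.1 * Complex.exp (p.2 * Complex.I)

lemma continuous_polarMap (z : ℂ) : Continuous (polarMap z) := by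
  unfold polarMap; fun_prop

lemma exists_polarMap_eq_zero {E : Type*} [Zero E] {f : ℂ → E} (hf : HasCompactSupport f) (z : ℂ) :
    ∃ R : ℝ, ∀ r θ : ℝ, R < |r| → f (polarMap z (r, θ)) = 0 := by
  obtain ⟨R, hR⟩ := hf.isCompact.isBounded.subset_closedBall z
  refine ⟨R, fun r θ hr => image_eq_zero_of_notMem_tsupport fun h => ?_⟩
  have := hR h
  rw [mem_closedBall, dist_eq_norm, polarMap, add_sub_cancel_left, norm_mul,
    Complex.norm_exp_ofReal_mul_I, mul_one, Complex.norm_real, Real.norm_eq_abs] at this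
  exact absurd hr this.not_gt

lemma integrableOn_polar {G : ℝ × ℝ → ℂ} (hG : Continuous G) {R : ℝ}
    (hR : ∀ r θ : ℝ, R < |r| → G (r, θ) = 0) :
    MeasureTheory.IntegrableOn G (Set.Ioi (0 : ℝ) ×ˢ Set.Ioo (-Real.pi) Real.pi) := by
  have h1 : MeasureTheory.IntegrableOn G (Set.Icc (0 : ℝ) R ×ˢ Set.Icc (-Real.pi) Real.pi) :=
    hG.continuousOn.integrableOn_compact (isCompact_Icc.prod isCompact_Icc)
  refine MeasureTheory.IntegrableOn.of_forall_sdiff_eq_zero h1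
    (measurableSet_Ioi.prod measurableSet_Ioo) ?_
  rintro ⟨r, θ⟩ ⟨⟨hr, hθ⟩, hn⟩
  refine hR _ _ ?_
  by_contra! h
  exact hn ⟨⟨le_of_lt hr, (le_abs_self r).trans h⟩, Set.Ioo_subset_Icc_self hθ⟩

lemma hasDerivAt_polarMap_fst (z : ℂ) (r θ : ℝ) :
    HasDerivAt (fun r : ℝ => polarMap z (r, θ)) (Complex.exp (θ * Complex.I)) r := by
  have := ((Complex.ofRealCLM.hasDerivAt (x := r)).mul_const
    (Complex.exp (θ * Complex.I))).const_add z
  simpa [polarMap] using this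

lemma hasDerivAt_polarMap_snd (z : ℂ) (r θ : ℝ) :
    HasDerivAt (fun θ : ℝ => polarMap z (r, θ))
      (r • (Complex.I * Complex.exp (θ * Complex.I))) θ := by
  have := ((((Complex.ofRealCLM.hasDerivAt (x := θ)).mul_const Complex.I).cexp).const_mul
    (r : ℂ)).const_add z
  simp only [Complex.ofRealCLM_apply, Complex.ofReal_one, one_mul] at this
  rwa [Complex.real_smul, mul_comm Complex.I]

/-- The Cauchy–Pompeiu formula. -/
lemma integral_inv_sub_mul_dbar {φ : ℂ → ℂ} (hφ : ContDiff ℝ 1 φ) (hc : HasCompactSupport φ)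
    (z : ℂ) : ∫ w, (w - z)⁻¹ * dbar φ w = -(2 * Real.pi) * φ z := by
  have hD := hφ.continuous_fderiv (by simp)
  have hdiff : ∀ w, HasFDerivAt φ (fderiv ℝ φ w) w := fun w =>
    (hφ.differentiable (by simp) w).hasFDerivAt
  set F : ℝ × ℝ → ℂ := fun p => fderiv ℝ φ (polarMap z p) (Complex.exp (p.2 * Complex.I))
    with hF
  set G : ℝ × ℝ → ℂ := fun p =>
    fderiv ℝ φ (polarMap z p) (Complex.I * Complex.exp (p.2 * Complex.I)) with hG
  have hpm := continuous_polarMap z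
  have hFc : Continuous F := (hD.comp hpm).clm_apply (by fun_prop)
  have hGc : Continuous G := (hD.comp hpm).clm_apply (by fun_prop)
  obtain ⟨R, hR⟩ := exists_polarMap_eq_zero hc z
  obtain ⟨R', hR'⟩ := exists_polarMap_eq_zero (hc.fderiv (𝕜 := ℝ)) z
  have hFi := integrableOn_polar hFc (R := R') fun r θ h => by simp [hF, hR' r θ h]
  have hGi := integrableOn_polar hGc (R := R') fun r θ h => by simp [hG, hR' r θ h]
  have hFint : ∫ p in Set.Ioi (0 : ℝ) ×ˢ Set.Ioo (-Real.pi) Real.pi, F p =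
      -(2 * Real.pi) * φ z := by
    rw [MeasureTheory.IntegrableOn, MeasureTheory.Measure.volume_eq_prod,
      ← MeasureTheory.Measure.prod_restrict] at hFi
    rw [MeasureTheory.Measure.volume_eq_prod, ← MeasureTheory.Measure.prod_restrict,
      MeasureTheory.integral_prod_symm _ hFi]
    have : ∀ θ : ℝ, ∫ r in Set.Ioi (0 : ℝ), F (r, θ) = -φ z := by
      intro θ
      have hder : ∀ r : ℝ, HasDerivAt (fun r => φ (polarMap z (r, θ))) (F (r, θ)) r :=
        fun r => (hdiff _).comp_hasDerivAt r (hasDerivAt_polarMap_fst z r θ)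
      have hint : MeasureTheory.IntegrableOn (fun r => F (r, θ)) (Set.Ioi 0) := by
        refine MeasureTheory.IntegrableOn.of_forall_sdiff_eq_zero (s := Set.Icc 0 R')
          ((hFc.comp (by fun_prop : Continuous fun r : ℝ => (r, θ))).continuousOn
            |>.integrableOn_compact isCompact_Icc) measurableSet_Ioi ?_
        rintro r ⟨hr, hn⟩
        have : fderiv ℝ φ (polarMap z (r, θ)) = 0 := by
          refine hR' _ _ ?_
          by_contra! h
          exact hn ⟨le_of_lt hr, (le_abs_self r).trans h⟩
        simp [hF, this]
      have := MeasureTheory.integral_Ioi_of_hasDerivAt_of_tendsto' (a := 0) (m := 0)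
        (fun r _ => hder r) hint (tendsto_const_nhds.congr' (by
          filter_upwards [eventually_gt_atTop R] with r hr
          exact (hR r θ (hr.trans_le (le_abs_self r))).symm))
      rw [this]
      simp [polarMap]
    simp only [this]
    rw [MeasureTheory.setIntegral_const]
    rw [Real.volume_real_Ioo_of_le (by linarith [Real.pi_pos]), Complex.real_smul]
    push_cast
    ring
  have hGint : ∫ p in Set.Ioi (0 : ℝ) ×ˢ Set.Ioo (-Real.pi) Real.pi, G p = 0 := by
    rw [MeasureTheory.Measure.volume_eq_prod] at hGi ⊢
    rw [MeasureTheory.setIntegral_prod _ hGi]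
    refine MeasureTheory.setIntegral_eq_zero_of_forall_eq_zero fun r hr => ?_
    have hr' : (r : ℝ) ≠ 0 := (Set.mem_Ioi.1 hr).ne'
    have hder : ∀ θ : ℝ, HasDerivAt (fun θ => φ (polarMap z (r, θ))) (r • G (r, θ)) θ := by
      intro θ
      have := (hdiff _).comp_hasDerivAt θ (hasDerivAt_polarMap_snd z r θ)
      rwa [map_smul] at this
    have hGr : Continuous fun θ : ℝ => r • G (r, θ) :=
      (hGc.comp (by fun_prop : Continuous fun θ : ℝ => (r, θ))).const_smul r
    have := intervalIntegral.integral_eq_sub_of_hasDerivAt (a := -Real.pi) (b := Real.pi)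
      (fun θ _ => hder θ) (hGr.intervalIntegrable _ _)
    rw [intervalIntegral.integral_smul, show polarMap z (r, Real.pi) = polarMap z (r, -Real.pi) by
      simp [polarMap, Complex.exp_neg], sub_self, smul_eq_zero_iff_right hr',
      intervalIntegral.integral_of_le (by linarith [Real.pi_pos]),
      MeasureTheory.integral_Ioc_eq_integral_Ioo] at this
    exact this
  calc ∫ w, (w - z)⁻¹ * dbar φ w = ∫ u, u⁻¹ * dbar φ (z + u) := by
        rw [← MeasureTheory.integral_add_left_eq_self _ z]
        simp
    _ = ∫ p in Set.Ioi (0 : ℝ) ×ˢ Set.Ioo (-Real.pi) Real.pi, (F p + Complex.I * G p) := by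
        rw [← Complex.integral_comp_polarCoord_symm]
        refine MeasureTheory.setIntegral_congr_fun
          (measurableSet_Ioi.prod measurableSet_Ioo) fun p hp => ?_
        have hp1 : (p.1 : ℂ) ≠ 0 := by exact_mod_cast (Set.mem_Ioi.1 hp.1).ne'
        have hpe := exp_neg_mul_dbar φ (polarMap z p) p.2
        simp only [hF, hG]
        rw [← hpe, Complex.polarCoord_symm_apply, Complex.ofReal_cos, Complex.ofReal_sin,
          ← Complex.exp_mul_I, Complex.real_smul, mul_inv, ← Complex.exp_neg, ← mul_assoc,
          ← mul_assoc, mul_inv_cancel₀ hp1, one_mul]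
        rfl
    _ = -(2 * Real.pi) * φ z := by
        rw [MeasureTheory.integral_add hFi (hGi.const_mul _), MeasureTheory.integral_const_mul,
          hFint, hGint, mul_zero, add_zero]

/-! ### Runge's theorem on simply connected domains -/

/-- A compact set whose frontier lies in a simply connected open set `Ω` lies in `Ω`. -/
lemma subset_of_frontier_subset_of_isSimplyConnected {Ω H : Set ℂ} (hΩo : IsOpen Ω)
    (hΩ : IsSimplyConnected Ω) (hH : IsCompact H) (hfr : frontier H ⊆ Ω) : H ⊆ Ω := by
  classical
  intro a haH
  by_contra haΩ
  obtain ⟨f, hfc, hf⟩ := Complex.exists_continuousOn_eqOn_exp_comp hΩ hΩo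
    (g := fun z => z - a) (by fun_prop) (by
      rintro ⟨z, hz, hza⟩
      exact haΩ (sub_eq_zero.1 hza ▸ hz))
  obtain ⟨h, hh⟩ := ContinuousMap.exists_restrict_eq (isClosed_frontier (s := H))
    ⟨(frontier H).domRestrict f, (hfc.mono hfr).domRestrict⟩
  set F : ℂ → ℂ := fun z => if z ∈ H then Complex.exp (h z) else z - a with hF
  have hFc : Continuous F := by
    refine Continuous.if (fun z hz => ?_) (by fun_prop) (by fun_prop)
    have h1 : h z = f z := DFunLike.congr_fun hh ⟨z, hz⟩
    rw [h1]
    exact hf (hfr hz)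
  have hF0 : ∀ z, F z ≠ 0 := by
    intro z
    by_cases hz : z ∈ H
    · simp [hF, hz]
    · simp only [hF, hz, if_false, sub_ne_zero]
      rintro rfl
      exact hz haH
  have : ContractibleSpace (Set.univ : Set ℂ) := convex_univ.contractibleSpace Set.univ_nonempty
  obtain ⟨G, hGc, hG⟩ := Complex.exists_continuousOn_eqOn_exp_comp
    (U := (Set.univ : Set ℂ)) (SimplyConnectedSpace.ofContractible _) isOpen_univ
    hFc.continuousOn (by
      rintro ⟨z, -, hz⟩
      exact hF0 z hz)
  rw [continuousOn_univ] at hGc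
  obtain ⟨R, hR⟩ := hH.isBounded.subset_ball a
  have hR0 : 0 < R := pos_of_mem_ball (hR haH)
  set g : ℝ → ℂ := fun θ => G (circleMap a R θ) - θ * Complex.I with hg
  have hgc : Continuous g := by
    have := continuous_circleMap a R
    fun_prop
  have hexp : ∀ θ, Complex.exp (g θ) = R := by
    intro θ
    have h1 : circleMap a R θ ∉ H := fun hmem => by
      have := hR hmem
      rw [mem_ball, dist_eq_norm, circleMap_sub_center, norm_circleMap_zero, abs_of_pos hR0] at this
      exact lt_irrefl _ this
    have h2 : Complex.exp (G (circleMap a R θ)) = R * Complex.exp (θ * Complex.I) := by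
      rw [← Function.comp_apply (f := Complex.exp), hG (Set.mem_univ _)]
      simp only [hF, if_neg h1, circleMap_sub_center, circleMap_zero]
    rw [hg, Complex.exp_sub, h2, mul_div_cancel_right₀ _ (Complex.exp_ne_zero _)]
  have hper : (g (2 * Real.pi)).im = (g 0).im - 2 * Real.pi := by
    simp [hg, circleMap]
  obtain ⟨θ, -, hθ⟩ := intermediate_value_uIcc (a := 0) (b := 2 * Real.pi)
    (f := fun θ => (g θ).im) (by fun_prop) (show (g 0).im - Real.pi ∈ _ by
      rw [hper, Set.mem_uIcc]
      exact Or.inr ⟨by linarith [Real.pi_pos], by linarith [Real.pi_pos]⟩)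
  obtain ⟨k, hk⟩ := Complex.exp_eq_exp_iff_exists_int.1 ((hexp θ).trans (hexp 0).symm)
  have him := congrArg Complex.im hk
  simp at hθ him
  have h3 : (2 * k : ℝ) * Real.pi = -1 * Real.pi := by linarith
  have h4 := mul_right_cancel₀ Real.pi_ne_zero h3
  have h5 : 2 * k = -1 := by exact_mod_cast h4
  omega

/-- A compact subset of a simply connected domain is contained in a compact subset `H` such that
the Cauchy kernels with poles off `H` are uniform limits of polynomials on `K`. -/
lemma exists_isCompact_inv_sub_mem_closure {Ω K : Set ℂ} (hΩo : IsOpen Ω)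
    (hΩ : IsSimplyConnected Ω) (hK : IsCompact K) (hKΩ : K ⊆ Ω) :
    ∃ H : Set ℂ, IsCompact H ∧ K ⊆ H ∧ H ⊆ Ω ∧ ∀ w ∉ H,
      ∃ g ∈ closure (polynomialFunctions K : Set C(K, ℂ)), ∀ z : K, g z = (w - z)⁻¹ := by
  have : CompactSpace K := isCompact_iff_compactSpace.1 hK
  set S := (polynomialFunctions K).topologicalClosure with hS
  have hSc : IsClosed (S : Set C(K, ℂ)) := Subalgebra.isClosed_topologicalClosure _
  have : CompleteSpace S := hSc.completeSpace_coe
  let x : S := ⟨Polynomial.toContinuousMapOnAlgHom K X,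
    Subalgebra.le_topologicalClosure _ ⟨X, trivial, rfl⟩⟩
  have hx : ∀ z : K, (x : C(K, ℂ)) z = z := fun z => by simp [x]
  have hspec : spectrum ℂ (x : C(K, ℂ)) = K := by
    rw [ContinuousMap.spectrum_eq_range]
    ext z
    simp only [Set.mem_range, hx]
    exact ⟨fun ⟨y, hy⟩ => hy ▸ y.2, fun hz => ⟨⟨z, hz⟩, rfl⟩⟩
  have hfr : frontier (spectrum ℂ x) ⊆ K :=
    (Subalgebra.frontier_spectrum S x).trans hspec.subset
  refine ⟨spectrum ℂ x, spectrum.isCompact x, ?_,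
    subset_of_frontier_subset_of_isSimplyConnected hΩo hΩ (spectrum.isCompact x)
      (hfr.trans hKΩ), ?_⟩
  · exact hspec.symm.subset.trans (spectrum.subset_subalgebra x)
  · intro w hw
    obtain ⟨u, hu⟩ := spectrum.notMem_iff.1 hw
    refine ⟨((↑u⁻¹ : S) : C(K, ℂ)), (↑u⁻¹ : S).2, fun z => ?_⟩
    have h1 : ((u : S) * (↑u⁻¹ : S) : S) = 1 := u.mul_inv
    have h2 := congrArg (fun y : S => (y : C(K, ℂ)) z) h1
    rw [hu] at h2
    refine eq_inv_of_mul_eq_one_right ?_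
    simpa [hx] using h2

/-- A holomorphic function can be cut off outside a compact set. -/
lemma exists_contDiff_eqOn_dbar_eq_zero {Ω H : Set ℂ} (hΩo : IsOpen Ω) (hH : IsCompact H)
    (hHΩ : H ⊆ Ω) {f : ℂ → ℂ} (hf : DifferentiableOn ℂ f Ω) :
    ∃ φ : ℂ → ℂ, ContDiff ℝ 1 φ ∧ HasCompactSupport φ ∧ Set.EqOn φ f H ∧
      Disjoint (tsupport (dbar φ)) H := by
  obtain ⟨L, hL, hHL, hLΩ⟩ := exists_compact_between hH hΩo hHΩ
  obtain ⟨χ, hχ1, hχ0, -⟩ := exists_contMDiffMap_one_nhds_of_subset_interior (n := 1)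
    (modelWithCornersSelf ℝ ℂ) hH.isClosed hHL
  have hχ : ContDiff ℝ 1 χ := χ.contMDiff.contDiff
  set φ : ℂ → ℂ := fun z => χ z • f z with hφ
  have hsupp : tsupport φ ⊆ L := by
    refine closure_minimal (fun z hz => ?_) hL.isClosed
    by_contra hzL
    exact hz (by simp [hφ, hχ0 z hzL])
  have hfr : ∀ z ∈ Ω, ContDiffAt ℝ 1 f z := fun z hz =>
    ((hf.contDiffOn hΩo).contDiffAt (hΩo.mem_nhds hz)).restrict_scalars ℝ
  have hφf : ∀ᶠ z in 𝓝ˢ H, φ z = f z := hχ1.mono fun z hz => by simp [hφ, hz]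
  refine ⟨φ, contDiff_iff_contDiffAt.2 fun z => ?_,
    hL.of_isClosed_subset (isClosed_tsupport _) hsupp, fun z hz => hφf.self_of_nhdsSet z hz, ?_⟩
  · by_cases hz : z ∈ tsupport φ
    · exact hχ.contDiffAt.smul (hfr z (hLΩ (hsupp hz)))
    · exact contDiffAt_const.congr_of_eventuallyEq (notMem_tsupport_iff_eventuallyEq.1 hz)
  · rw [Set.disjoint_right]
    intro w hw
    rw [notMem_tsupport_iff_eventuallyEq]
    have h1 := eventually_nhdsSet_iff_forall.1 hφf w hw
    filter_upwards [h1.eventually_nhds, hΩo.mem_nhds (hHΩ hw)] with y hy hyΩ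
    have h2 : HasFDerivAt φ ((fderiv ℂ f y).restrictScalars ℝ) y :=
      (((hf y hyΩ).differentiableAt (hΩo.mem_nhds hyΩ)).hasFDerivAt.restrictScalars
        ℝ).congr_of_eventuallyEq hy
    have h3 : fderiv ℂ f y Complex.I = Complex.I * fderiv ℂ f y 1 := by
      rw [← smul_eq_mul, ← map_smul, smul_eq_mul, mul_one]
    rw [dbar, h2.fderiv]
    simp only [ContinuousLinearMap.coe_restrictScalars', h3, Pi.zero_apply]
    rw [← mul_assoc, Complex.I_mul_I]
    ring

/-- **Runge's theorem**: on a simply connected open set, holomorphic functions are uniform limits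
of polynomials on compact subsets. -/
lemma exists_polynomial_norm_sub_lt {Ω K : Set ℂ} (hΩo : IsOpen Ω)
    (hΩ : IsSimplyConnected Ω) (hK : IsCompact K) (hKΩ : K ⊆ Ω) {f : ℂ → ℂ}
    (hf : DifferentiableOn ℂ f Ω) {ε : ℝ} (hε : 0 < ε) :
    ∃ p : ℂ[X], ∀ z ∈ K, ‖f z - p.eval z‖ < ε := by
  have : CompactSpace K := isCompact_iff_compactSpace.1 hK
  obtain ⟨H, hH, hKH, hHΩ, hker⟩ := exists_isCompact_inv_sub_mem_closure hΩo hΩ hK hKΩ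
  obtain ⟨φ, hφ, hφc, hφf, hdisj⟩ := exists_contDiff_eqOn_dbar_eq_zero hΩo hH hHΩ hf
  set S := (polynomialFunctions K).topologicalClosure with hS
  have hSc : IsClosed (S : Set C(K, ℂ)) := Subalgebra.isClosed_topologicalClosure _
  have : CompleteSpace S := hSc.completeSpace_coe
  have hdc : HasCompactSupport (dbar φ) := by
    refine (hφc.fderiv (𝕜 := ℝ)).mono fun w hw h0 => hw ?_
    simp [dbar, h0]
  have hcont : Continuous fun p : ℂ × K => (p.1 - p.2)⁻¹ * dbar φ p.1 := by
    rw [continuous_iff_continuousAt]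
    rintro ⟨w, z⟩
    by_cases hw : w ∈ tsupport (dbar φ)
    · have hne : w - z ≠ 0 := fun h => Set.disjoint_left.1 hdisj hw
        (by rw [sub_eq_zero.1 h]; exact hKH z.2)
      have h1 : ContinuousAt (fun p : ℂ × K => p.1 - p.2) (w, z) := by fun_prop
      exact (h1.inv₀ hne).mul ((continuous_dbar hφ).comp continuous_fst).continuousAt
    · refine (continuousAt_const (y := (0 : ℂ))).congr ?_
      filter_upwards [continuous_fst.continuousAt.eventually
        (notMem_tsupport_iff_eventuallyEq.1 hw)] with p hp
      rw [hp, Pi.zero_apply, mul_zero]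
  let Φ : C(ℂ, C(K, ℂ)) := ContinuousMap.curry ⟨_, hcont⟩
  have hΦ : ∀ w z, Φ w z = (w - z)⁻¹ * dbar φ w := fun w z => rfl
  have hΦS : ∀ w, Φ w ∈ S := by
    intro w
    by_cases hw : w ∈ tsupport (dbar φ)
    · obtain ⟨g, hg, hgz⟩ := hker w (Set.disjoint_left.1 hdisj hw)
      convert S.smul_mem hg (dbar φ w) using 1
      ext z
      rw [hΦ, ContinuousMap.smul_apply, hgz, smul_eq_mul, mul_comm]
    · convert S.zero_mem using 1
      ext z
      rw [hΦ, image_eq_zero_of_notMem_tsupport hw, mul_zero, ContinuousMap.zero_apply]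
  let Φ' : ℂ → S := fun w => ⟨Φ w, hΦS w⟩
  have hΦ'c : Continuous Φ' := Φ.continuous.subtype_mk _
  have hΦ'i : MeasureTheory.Integrable Φ' := by
    refine hΦ'c.integrable_of_hasCompactSupport (hdc.mono fun w hw h0 => hw ?_)
    refine Subtype.ext (ContinuousMap.ext fun z => ?_)
    change Φ w z = 0
    rw [hΦ, h0, mul_zero]
  have hint := (Subalgebra.toSubmodule S).subtypeL.integral_comp_comm hΦ'i
  have hΦi : MeasureTheory.Integrable Φ :=
    (Subalgebra.toSubmodule S).subtypeL.integrable_comp hΦ'i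
  have hmem : ∫ w, Φ w ∈ S := by
    have : ∫ w, Φ w = ((∫ w, Φ' w : S) : C(K, ℂ)) := hint
    rw [this]
    exact Subtype.property _
  have hf_eq : ∀ z : K, ((-(2 * Real.pi : ℂ))⁻¹ • ∫ w, Φ w) z = f z := by
    intro z
    have hpi : (-(2 * Real.pi : ℂ)) ≠ 0 := by simp [Real.pi_ne_zero]
    rw [ContinuousMap.smul_apply, ContinuousMap.integral_apply hΦi]
    simp only [hΦ]
    rw [integral_inv_sub_mul_dbar hφ hφc, hφf (hKH z.2), smul_eq_mul, inv_mul_cancel_left₀ hpi]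
  obtain ⟨g, ⟨p, -, rfl⟩, hg⟩ := Metric.mem_closure_iff.1
    (show _ ∈ closure (polynomialFunctions K : Set C(K, ℂ)) from
      S.smul_mem hmem (-(2 * Real.pi : ℂ))⁻¹) ε hε
  refine ⟨p, fun z hz => ?_⟩
  rw [dist_eq_norm] at hg
  have := (ContinuousMap.norm_coe_le_norm _ (⟨z, hz⟩ : K)).trans_lt hg
  rw [ContinuousMap.sub_apply, hf_eq] at this
  simpa using this

/-! ### The space `H(Ω)` -/

/-- The restriction of a function in `H(Ω)` to `Ω`, as a continuous map. -/
def Hol.toContinuousMap {Ω : Set ℂ} (f : Hol Ω) : C(Ω, ℂ) :=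
  ⟨Ω.domRestrict f.1, f.2.1.continuousOn.domRestrict⟩

lemma Hol.isInducing_toContinuousMap (Ω : Set ℂ) :
    IsInducing (Hol.toContinuousMap (Ω := Ω)) := by
  rw [← ContinuousMap.isUniformEmbedding_toUniformOnFunIsCompact.isEmbedding.isInducing.of_comp_iff]
  exact ⟨rfl⟩

lemma Hol.tendsto_iff {Ω : Set ℂ} (hΩo : IsOpen Ω) {ι : Type*} {l : Filter ι} {F : ι → Hol Ω}
    {f : Hol Ω} :
    Tendsto F l (𝓝 f) ↔ TendstoLocallyUniformlyOn (fun i => (F i).1) f.1 l Ω := by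
  have : LocallyCompactSpace Ω := hΩo.locallyCompactSpace
  rw [(Hol.isInducing_toContinuousMap Ω).tendsto_nhds_iff,
    ContinuousMap.tendsto_iff_tendstoLocallyUniformly,
    tendstoLocallyUniformlyOn_iff_tendstoLocallyUniformly_comp_coe]
  rfl

lemma Hol.injective_toContinuousMap (Ω : Set ℂ) :
    Function.Injective (Hol.toContinuousMap (Ω := Ω)) := by
  intro f g h
  refine Subtype.ext (funext fun z => ?_)
  by_cases hz : z ∈ Ω
  · exact DFunLike.congr_fun h ⟨z, hz⟩
  · rw [f.2.2 z hz, g.2.2 z hz]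

open Classical in
lemma Hol.isClosed_range_toContinuousMap {Ω : Set ℂ} (hΩo : IsOpen Ω) :
    IsClosed (Set.range (Hol.toContinuousMap (Ω := Ω))) := by
  have : LocallyCompactSpace Ω := hΩo.locallyCompactSpace
  refine isClosed_of_closure_subset fun g hg => ?_
  set l := comap (Hol.toContinuousMap (Ω := Ω)) (𝓝 g) with hl
  have : l.NeBot := comap_neBot fun t ht => by
    obtain ⟨_, hft, f, rfl⟩ := mem_closure_iff_nhds.1 hg t ht
    exact ⟨f, hft⟩
  set G : ℂ → ℂ := fun z => if hz : z ∈ Ω then g ⟨z, hz⟩ else 0 with hG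
  have hGg : ∀ z : Ω, G z = g z := fun z => by simp [hG]
  have hlim : TendstoLocallyUniformlyOn (fun f : Hol Ω => f.1) G l Ω := by
    rw [tendstoLocallyUniformlyOn_iff_tendstoLocallyUniformly_comp_coe,
      show G ∘ Subtype.val = g from funext hGg]
    exact ContinuousMap.tendsto_iff_tendstoLocallyUniformly.1 tendsto_comap
  refine ⟨⟨G, hlim.differentiableOn (Eventually.of_forall fun f => f.2.1) hΩo,
    fun z hz => by simp [hG, hz]⟩, ContinuousMap.ext hGg⟩

lemma Hol.baireSpace {Ω : Set ℂ} (hΩo : IsOpen Ω) : BaireSpace (Hol Ω) := by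
  have : LocallyCompactSpace Ω := hΩo.locallyCompactSpace
  have hce : IsClosedEmbedding (Hol.toContinuousMap (Ω := Ω)) :=
    ⟨⟨Hol.isInducing_toContinuousMap Ω, Hol.injective_toContinuousMap Ω⟩,
      Hol.isClosed_range_toContinuousMap hΩo⟩
  have := hce.IsCompletelyPseudoMetrizableSpace
  infer_instance

lemma Hol.continuous_tc {Ω : Set ℂ} (hΩo : IsOpen Ω) (hΩ0 : (0 : ℂ) ∈ Ω) :
    Continuous fun f : Hol Ω => tc f.1 := by
  refine continuous_pi fun k => (continuous_iff_continuousAt.2 fun f => ?_).div_const _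
  have key : ∀ k : ℕ, (∀ g : Hol Ω, DifferentiableOn ℂ (iteratedDeriv k g.1) Ω) ∧
      TendstoLocallyUniformlyOn (fun g : Hol Ω => iteratedDeriv k g.1) (iteratedDeriv k f.1)
        (𝓝 f) Ω := by
    intro k
    induction k with
    | zero => exact ⟨by simpa using fun g : Hol Ω => g.2.1, by
        simpa using (Hol.tendsto_iff hΩo).1 (tendsto_id (x := 𝓝 f))⟩
    | succ k ih =>
      simp only [iteratedDeriv_succ]
      exact ⟨fun g => (ih.1 g).deriv hΩo, ih.2.deriv (Eventually.of_forall ih.1) hΩo⟩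
  exact (key k).2.tendsto_at hΩ0

/-- A polynomial as an element of `H(Ω)`. -/
def Hol.ofPolynomial (Ω : Set ℂ) (p : ℂ[X]) : Hol Ω :=
  ⟨Ω.indicator fun z => p.eval z, p.differentiable.differentiableOn.congr fun _ hz =>
    Set.indicator_of_mem hz _, fun _ hz => Set.indicator_of_notMem hz _⟩

lemma Hol.ofPolynomial_apply {Ω : Set ℂ} (p : ℂ[X]) {z : ℂ} (hz : z ∈ Ω) :
    (Hol.ofPolynomial Ω p).1 z = p.eval z :=
  Set.indicator_of_mem hz fun z => p.eval z

lemma iteratedDeriv_polynomial_eval (p : ℂ[X]) (k : ℕ) :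
    iteratedDeriv k (fun z => p.eval z) = fun z => (derivative^[k] p).eval z := by
  induction k with
  | zero => simp
  | succ k ih =>
    rw [iteratedDeriv_succ, ih, Function.iterate_succ_apply']
    ext z
    exact Polynomial.deriv _

lemma Hol.tc_ofPolynomial {Ω : Set ℂ} (hΩo : IsOpen Ω) (hΩ0 : (0 : ℂ) ∈ Ω) (p : ℂ[X]) :
    tc (Hol.ofPolynomial Ω p).1 = p.coeff := by
  ext k
  have h : (Hol.ofPolynomial Ω p).1 =ᶠ[𝓝 0] fun z => p.eval z := by
    filter_upwards [hΩo.mem_nhds hΩ0] with z hz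
    exact Hol.ofPolynomial_apply p hz
  rw [tc, h.iteratedDeriv_eq, iteratedDeriv_polynomial_eval]
  beta_reduce
  rw [← coeff_zero_eq_eval_zero,
    coeff_iterate_derivative, zero_add, Nat.descFactorial_self, nsmul_eq_mul,
    mul_div_cancel_left₀ _ (by exact_mod_cast k.factorial_ne_zero)]

lemma Hol.continuous_ofPolynomial_eval (Ω : Set ℂ) (B : ℂ[X][X]) :
    Continuous fun c : ℂ => Hol.ofPolynomial Ω (B.eval (C c)) := by
  rw [(Hol.isInducing_toContinuousMap Ω).continuous_iff]
  refine ContinuousMap.continuous_of_continuous_uncurry _ ?_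
  have : ∀ p : ℂ × Ω, (Hol.ofPolynomial Ω (B.eval (C p.1))).1 p.2 =
      ∑ i ∈ Finset.range (B.natDegree + 1), (B.coeff i).eval (p.2 : ℂ) * p.1 ^ i := by
    intro p
    rw [Hol.ofPolynomial_apply _ p.2.2]
    simp [eval_eq_sum_range (p := B), eval_finsetSum]
  refine (continuous_congr this).2 ?_
  fun_prop

lemma Hol.denseRange_ofPolynomial {Ω : Set ℂ} (hΩo : IsOpen Ω) (hΩ : IsSimplyConnected Ω) :
    DenseRange (Hol.ofPolynomial Ω) := by
  intro f
  have : LocallyCompactSpace Ω := hΩo.locallyCompactSpace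
  let K : CompactExhaustion Ω := default
  have happ : ∀ n : ℕ, ∃ p : ℂ[X], ∀ z ∈ Subtype.val '' K n,
      ‖f.1 z - p.eval z‖ < 1 / ((n : ℝ) + 1) := fun n =>
    exists_polynomial_norm_sub_lt hΩo hΩ ((K.isCompact n).image continuous_subtype_val)
      (Subtype.coe_image_subset _ _) f.2.1 Nat.one_div_pos_of_nat
  choose p hp using happ
  refine mem_closure_of_tendsto (f := fun n => Hol.ofPolynomial Ω (p n)) (b := atTop) ?_
    (Eventually.of_forall fun n => Set.mem_range_self _)
  rw [(Hol.isInducing_toContinuousMap Ω).tendsto_nhds_iff,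
    ContinuousMap.tendsto_iff_forall_isCompact_tendstoUniformlyOn]
  intro L hL
  obtain ⟨N, hN⟩ := K.exists_superset_of_isCompact hL
  rw [Metric.tendstoUniformlyOn_iff]
  intro ε hε
  filter_upwards [eventually_ge_atTop N,
    tendsto_one_div_add_atTop_nhds_zero_nat.eventually_lt_const hε] with n hn hnε z hz
  have h1 := hp n z ⟨z, K.subset hn (hN hz), rfl⟩
  rw [dist_eq_norm]
  refine lt_of_eq_of_lt ?_ (h1.trans hnε)
  congr 2
  exact Hol.ofPolynomial_apply _ z.2

/-- Theorem 3.7 : for a simply connected domain `Ω ∋ 0` and a sequence `(m_k, n_k)_k`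
of pairs of positive integers with `(m_k)_k` unbounded, the set of `f ∈ H(Ω)` for which
there is an infinite subsequence along which `f ∈ 𝒩_{m_k,n_k}` and the poles of the
Padé approximants `[f; m_k/n_k]` tend to infinity, is a dense `G_δ` subset of `H(Ω)`;
the same holds in the space `𝔽 = ℂ^ℕ` with the product topology. -/
theorem stmt_8 (Ω : Set ℂ) (hΩo : IsOpen Ω) (hΩ0 : (0 : ℂ) ∈ Ω) (hΩc : IsConnected Ω)
    (hΩsc : SimplyConnectedSpace Ω)
    (m n : ℕ → ℕ) (hm : ∀ k, 0 < m k) (hn : ∀ k, 0 < n k)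
    (hub : ∀ N : ℕ, ∃ k, N < m k) :
    (IsGδ {f : Hol Ω | ∃ σ : ℕ → ℕ, StrictMono σ ∧
        ∃ P Q : ℕ → Polynomial ℂ,
          (∀ k, tc f.1 ∈ Nset (m (σ k)) (n (σ k)) ∧
            IsPade (tc f.1) (m (σ k)) (n (σ k)) (P k) (Q k)) ∧
          ∀ R : ℝ, 0 < R → ∃ N : ℕ, ∀ k ≥ N, ∀ z : ℂ, (Q k).eval z = 0 → R < ‖z‖} ∧
      Dense {f : Hol Ω | ∃ σ : ℕ → ℕ, StrictMono σ ∧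
        ∃ P Q : ℕ → Polynomial ℂ,
          (∀ k, tc f.1 ∈ Nset (m (σ k)) (n (σ k)) ∧
            IsPade (tc f.1) (m (σ k)) (n (σ k)) (P k) (Q k)) ∧
          ∀ R : ℝ, 0 < R → ∃ N : ℕ, ∀ k ≥ N, ∀ z : ℂ, (Q k).eval z = 0 → R < ‖z‖}) ∧
    (IsGδ {a : ℕ → ℂ | ∃ σ : ℕ → ℕ, StrictMono σ ∧
        ∃ P Q : ℕ → Polynomial ℂ,
          (∀ k, a ∈ Nset (m (σ k)) (n (σ k)) ∧
            IsPade a (m (σ k)) (n (σ k)) (P k) (Q k)) ∧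
          ∀ R : ℝ, 0 < R → ∃ N : ℕ, ∀ k ≥ N, ∀ z : ℂ, (Q k).eval z = 0 → R < ‖z‖} ∧
      Dense {a : ℕ → ℂ | ∃ σ : ℕ → ℕ, StrictMono σ ∧
        ∃ P Q : ℕ → Polynomial ℂ,
          (∀ k, a ∈ Nset (m (σ k)) (n (σ k)) ∧
            IsPade a (m (σ k)) (n (σ k)) (P k) (Q k)) ∧
          ∀ R : ℝ, 0 < R → ∃ N : ℕ, ∀ k ≥ N, ∀ z : ℂ, (Q k).eval z = 0 → R < ‖z‖}) := by
  have := Hol.baireSpace hΩo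
  exact ⟨isGδ_and_dense_of_denseRange (fun f : Hol Ω => tc f.1) (Hol.continuous_tc hΩo hΩ0)
    (Hol.ofPolynomial Ω) (Hol.denseRange_ofPolynomial hΩo hΩsc) (Hol.tc_ofPolynomial hΩo hΩ0)
    (Hol.continuous_ofPolynomial_eval Ω) m n hn hub,
    isGδ_and_dense_of_denseRange id continuous_id (fun p => p.coeff) denseRange_coeff
      (fun _ => rfl) (fun B => continuous_pi (continuous_coeff_eval_C B)) m n hn hub⟩

end
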